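/- Let G' be the connected tree-of-gadgets graph obtained from the m gadget copies and an arbitrary tree T on m nodes, and let S be the 3-Partition-derived stack sequence with threshold t = B+4. Then every placement of S that empties the board satisfies the following at the configuration reached after placing S_initial (the first 6m stacks): every gadget contains exactly six stacks, and these six stacks use exactly three colors, each of these three colors having both of its two stacks within that same gadget (in particular, no color is split across two gadgets). -/

import Mathlib

open scoped Classical

namespace Hexasort

/-- A board configuration: each vertex holds either a stack `(color, height)` or nothing. -/
abbrev Config (V C : Type*) := V → Option (C × ℕ)

/-- The everywhere-empty configuration. -/
def emptyConfig (V C : Type*) : Config V C := fun _ => none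

/-- The height contributed by a board entry to color `c` (0 if empty or another color). -/
noncomputable def colorHeight {C : Type*} (e : Option (C × ℕ)) (c : C) : ℕ :=
  match e with
  | none => 0
  | some (c', h) => if c' = c then h else 0

/-- Total height of the color-`c` stacks on the neighbors of `x`. -/
noncomputable def neighborSum {V C : Type*} [Fintype V] (G : SimpleGraph V)
    (δ : Config V C) (c : C) (x : V) : ℕ :=
  ∑ y ∈ Finset.univ.filter (fun y => G.Adj x y), colorHeight (δ y) c

/-- The configuration resulting from placing the stack `s` on the vertex `x`:
all same-colored neighbors are emptied, and `x` gets the merged stack unless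
its total height reaches the threshold `t`, in which case `x` becomes empty. -/
noncomputable def place {V C : Type*} [Fintype V] (G : SimpleGraph V) (t : ℕ)
    (δ : Config V C) (s : C × ℕ) (x : V) : Config V C :=
  fun v =>
    if v = x then
      (if t ≤ s.2 + neighborSum G δ s.1 x then none
       else some (s.1, s.2 + neighborSum G δ s.1 x))
    else if G.Adj x v ∧ (∃ hh, δ v = some (s.1, hh)) then none
    else δ v

/-- Play a sequence of stacks on a sequence of vertices, starting from `δ`. -/
noncomputable def play {V C : Type*} [Fintype V] (G : SimpleGraph V) (t : ℕ) :
    Config V C → List (C × ℕ) → List V → Config V C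
  | δ, [], _ => δ
  | δ, _ :: _, [] => δ
  | δ, s :: S, x :: p => play G t (place G t δ s x) S p

/-- Legality of playing the stacks `S` on the vertices `p`, starting from `δ`:
each stack is placed on a vertex that is empty at that moment. -/
inductive Legal {V C : Type*} [Fintype V] (G : SimpleGraph V) (t : ℕ) :
    Config V C → List (C × ℕ) → List V → Prop
  | nil (δ : Config V C) : Legal G t δ [] []
  | cons {δ : Config V C} (s : C × ℕ) (S : List (C × ℕ)) (x : V) (p : List V) :
      δ x = none → Legal G t (place G t δ s x) S p →
      Legal G t δ (s :: S) (x :: p)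

/-- `S` is fittable on `(G, t)`: all stacks can be placed in order. -/
def Fittable {V C : Type*} [Fintype V] (G : SimpleGraph V) (t : ℕ)
    (S : List (C × ℕ)) : Prop :=
  ∃ p : List V, Legal G t (emptyConfig V C) S p

/-- `S` is emptyable on `(G, t)`: all stacks can be placed in order so that the
final configuration is everywhere empty. -/
def Emptyable {V C : Type*} [Fintype V] (G : SimpleGraph V) (t : ℕ)
    (S : List (C × ℕ)) : Prop :=
  ∃ p : List V, Legal G t (emptyConfig V C) S p ∧
    play G t (emptyConfig V C) S p = emptyConfig V C

end Hexasort

namespace Hexasort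

/-- The vertices of the ten-vertex gadget graph `H`: a center `x`, a leaf `s` adjacent
to the center, and four arms `x – la i – lb i` for `i ∈ {0,1,2,3}`. -/
inductive GadgetV : Type
  | x | s | la : Fin 4 → GadgetV | lb : Fin 4 → GadgetV
  deriving DecidableEq, Fintype

/-- The base (asymmetric) adjacency relation of the gadget graph `H`. -/
def gadgetRel : GadgetV → GadgetV → Prop := fun u v =>
  (u = .x ∧ v = .s) ∨ (∃ i, u = .x ∧ v = .la i) ∨ (∃ i, u = .la i ∧ v = .lb i)

/-- The disjoint union of `m` copies of the gadget graph `H`. -/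
def disjointGadgets (m : ℕ) : SimpleGraph (Fin m × GadgetV) :=
  SimpleGraph.fromRel (fun u v => u.1 = v.1 ∧ gadgetRel u.2 v.2)

/-- Colors for the 3-Partition reduction: `some (j, 0/1/2)` are `red_j`, `blue_j`,
`green_j`, and `none` is the color black. -/
abbrev GColor (m : ℕ) := Option (Fin m × Fin 3)

/-- `S_initial`: for each gadget `j`, two stacks of height `t−1` of each of the three
gadget colors `red_j, blue_j, green_j`. -/
def SinitialG (m t : ℕ) : List (GColor m × ℕ) :=
  (List.finRange m).flatMap (fun j =>
    [(some (j, 0), t-1), (some (j, 0), t-1), (some (j, 1), t-1),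
     (some (j, 1), t-1), (some (j, 2), t-1), (some (j, 2), t-1)])

/-- `S_A`: the black stacks encoding the 3-Partition input values. -/
def SAG (m : ℕ) (a : Fin (3*m) → ℕ) : List (GColor m × ℕ) :=
  (List.finRange (3*m)).map (fun i => ((none : GColor m), a i))

/-- `S_connector`: for each gadget `j`, one stack of height `t−1` of each gadget color. -/
def SconnectorG (m t : ℕ) : List (GColor m × ℕ) :=
  (List.finRange m).flatMap (fun j =>
    [(some (j, 0), t-1), (some (j, 1), t-1), (some (j, 2), t-1)])

/-- `S_final`: for each gadget, four black stacks of height `1`. -/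
def SfinalG (m : ℕ) : List (GColor m × ℕ) :=
  (List.finRange m).flatMap (fun _ =>
    [((none : GColor m), 1), (none, 1), (none, 1), (none, 1)])

/-- The full stack sequence `S = S_initial + S_A + S_connector + S_final`. -/
def SfullG (m : ℕ) (a : Fin (3*m) → ℕ) (t : ℕ) : List (GColor m × ℕ) :=
  SinitialG m t ++ SAG m a ++ SconnectorG m t ++ SfinalG m

end Hexasort

namespace Hexasort

/-- The connected tree-of-gadgets graph `G'`: `m` gadget copies whose `s` vertices are
additionally connected according to the tree `T` (identifying `s` of gadget `j` with
the tree node `t_j`). -/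
def treeGadgets (m : ℕ) (T : SimpleGraph (Fin m)) : SimpleGraph (Fin m × GadgetV) :=
  SimpleGraph.fromRel (fun u v =>
    (u.1 = v.1 ∧ gadgetRel u.2 v.2) ∨
    (u.2 = .s ∧ v.2 = .s ∧ T.Adj u.1 v.1))

end Hexasort

namespace Hexasort

section Aux

variable {V C : Type*} [Fintype V] {G : SimpleGraph V} {t : ℕ}

lemma legal_length {δ : Config V C} {S : List (C × ℕ)} {p : List V}
    (h : Legal G t δ S p) : S.length = p.length := by
  induction h with
  | nil => rfl
  | cons s S x p _ _ ih => simp [ih]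

lemma legal_step {δ : Config V C} {S : List (C × ℕ)} {p : List V}
    (h : Legal G t δ S p) : ∀ (n : ℕ) (s : C × ℕ) (x : V), S[n]? = some s → p[n]? = some x →
      play G t δ (S.take n) (p.take n) x = none ∧
      play G t δ (S.take (n+1)) (p.take (n+1)) =
        place G t (play G t δ (S.take n) (p.take n)) s x := by
  induction h with
  | nil => intro n s x hs; simp at hs
  | @cons δ s0 S x0 p h0 hl ih =>
    intro n s x hs hx
    cases n with
    | zero =>
      simp at hs hx
      subst hs hx
      simp [play, h0]
    | succ n =>
      simp at hs hx
      have := ih n s x hs hx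
      simpa [play] using this

lemma place_other {δ : Config V C} {s : C × ℕ} {x : V} (hx : δ x = none) {c : C}
    (hc : s.1 ≠ c) (v : V) (h : ℕ) : place G t δ s x v = some (c, h) ↔ δ v = some (c, h) := by
  unfold place
  by_cases hv : v = x
  · subst hv
    simp only [if_true, hx]
    split_ifs <;> simp [hc]
  · simp only [hv, if_false]
    split_ifs with h1
    · obtain ⟨_, hh, e⟩ := h1
      simp [e, hc]
    · rfl

lemma const_other {cfg : ℕ → Config V C} {Sf : ℕ → C × ℕ} {pf : ℕ → V} {N : ℕ}
    (h1 : ∀ n < N, cfg n (pf n) = none)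
    (h2 : ∀ n < N, cfg (n+1) = place G t (cfg n) (Sf n) (pf n)) {c : C} (i : ℕ)
    (j : ℕ) (hij : i ≤ j) : j ≤ N → (∀ n, i ≤ n → n < j → (Sf n).1 ≠ c) →
    ∀ v h, cfg j v = some (c, h) ↔ cfg i v = some (c, h) := by
  induction j, hij using Nat.le_induction with
  | base => intros; rfl
  | succ j hij ih =>
    intro hN hn v h
    rw [h2 j (by omega), place_other (h1 j (by omega)) (hn j hij (by omega))]
    exact ih (by omega) (fun n a b => hn n a (by omega)) v h

lemma nsum_zero {δ : Config V C} {c : C} {x : V}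
    (h : ∀ v, G.Adj x v → ∀ k, δ v ≠ some (c, k)) : neighborSum G δ c x = 0 := by
  unfold neighborSum
  apply Finset.sum_eq_zero
  intro y hy
  simp at hy
  have := h y hy
  unfold colorHeight
  rcases hd : δ y with _ | ⟨c', k⟩
  · rfl
  · simp only
    rw [if_neg]
    rintro rfl
    exact this k hd

lemma nsum_ge {δ : Config V C} {c : C} {x v : V} {k : ℕ}
    (ha : G.Adj x v) (h : δ v = some (c, k)) : k ≤ neighborSum G δ c x := by
  unfold neighborSum
  have := Finset.single_le_sum (f := fun y => colorHeight (δ y) c) (s := Finset.univ.filter (fun y => G.Adj x y)) (fun _ _ => Nat.zero_le _) (a := v) (by simpa using ha)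
  simpa [colorHeight, h] using this

/-- Behaviour of a colour appearing exactly three times with height `t-1`. -/
lemma color_life {cfg : ℕ → Config V C} {Sf : ℕ → C × ℕ} {pf : ℕ → V} {N : ℕ} (ht : 2 ≤ t)
    (h1 : ∀ n < N, cfg n (pf n) = none)
    (h2 : ∀ n < N, cfg (n+1) = place G t (cfg n) (Sf n) (pf n))
    (h0 : cfg 0 = emptyConfig V C) (hN : cfg N = emptyConfig V C) {c : C} {n1 n2 n3 : ℕ}
    (h12 : n1 < n2) (h23 : n2 < n3) (h3N : n3 < N)
    (e1 : Sf n1 = (c, t-1)) (e2 : Sf n2 = (c, t-1)) (e3 : Sf n3 = (c, t-1))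
    (honly : ∀ n < N, (Sf n).1 = c → n = n1 ∨ n = n2 ∨ n = n3) :
    G.Adj (pf n3) (pf n1) ∧ G.Adj (pf n3) (pf n2) ∧ pf n1 ≠ pf n2 ∧
    ∀ n, n2 < n → n ≤ n3 → ∀ v h, cfg n v = some (c, h) ↔ h = t-1 ∧ (v = pf n1 ∨ v = pf n2) := by
  have A1 : ∀ v h, cfg n1 v ≠ some (c, h) := by
    intro v h
    rw [Ne, const_other h1 h2 0 n1 (by omega) (by omega)
      (fun n a b e => by have := honly n (by omega) e; omega), h0]
    simp [emptyConfig]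
  have A2 : ∀ v h, cfg (n1+1) v = some (c, h) ↔ h = t-1 ∧ v = pf n1 := by
    intro v h
    rw [h2 n1 (by omega), e1]
    unfold place
    rw [nsum_zero (fun v _ k => A1 v k)]
    by_cases hv : v = pf n1
    · subst hv
      simp only [if_true, and_true]
      rw [if_neg (by simp; omega)]
      simp; exact eq_comm
    · simp only [hv, if_false, and_false, iff_false]
      split_ifs
      · simp
      · exact A1 v h
  have A3 : ∀ v h, cfg n2 v = some (c, h) ↔ h = t-1 ∧ v = pf n1 := by
    intro v h
    rw [const_other h1 h2 (n1+1) n2 (by omega) (by omega)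
      (fun n a b e => by have := honly n (by omega) e; omega), A2]
  have hne : pf n1 ≠ pf n2 := by
    intro e
    have a := (A3 (pf n1) (t-1)).2 ⟨rfl, rfl⟩
    have b := h1 n2 (by omega)
    rw [← e, a] at b
    simp at b
  have A5 : ∀ v h, cfg n3 v = some (c, h) ↔ cfg (n2+1) v = some (c, h) := by
    intro v h
    rw [const_other h1 h2 (n2+1) n3 (by omega) (by omega)
      (fun n a b e => by have := honly n (by omega) e; omega)]
  have A6 : ∀ v h, cfg (n3+1) v ≠ some (c, h) := by
    intro v h e
    rw [← const_other h1 h2 (n3+1) N (by omega) le_rfl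
      (fun n a b e => by have := honly n (by omega) e; omega), hN] at e
    simp [emptyConfig] at e
  -- the first two are not adjacent
  have hnadj : ¬ G.Adj (pf n2) (pf n1) := by
    intro hadj
    have E : ∀ v h, cfg (n2+1) v ≠ some (c, h) := by
      intro v h
      rw [h2 n2 (by omega), e2]
      have := nsum_ge hadj ((A3 (pf n1) (t-1)).2 ⟨rfl, rfl⟩)
      unfold place
      by_cases hv : v = pf n2
      · subst hv
        simp only [if_true]
        rw [if_pos (by omega)]
        simp
      · simp only [hv, if_false]
        split_ifs with hh
        · simp
        · intro e
          have := (A3 v h).1 e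
          apply hh
          rw [this.2]
          exact ⟨hadj, _, (A3 (pf n1) (t-1)).2 ⟨rfl, rfl⟩⟩
    apply A6 (pf n3) (t-1)
    rw [h2 n3 (by omega), e3]
    unfold place
    rw [nsum_zero (fun v _ k => by rw [Ne, A5]; exact E v k)]
    simp only [if_true]
    rw [if_neg (by simp; omega)]
    simp
  have A4 : ∀ v h, cfg (n2+1) v = some (c, h) ↔ h = t-1 ∧ (v = pf n1 ∨ v = pf n2) := by
    intro v h
    rw [h2 n2 (by omega), e2]
    unfold place
    rw [nsum_zero (fun v hv k => by
      rw [Ne, A3]; rintro ⟨_, rfl⟩; exact hnadj hv)]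
    by_cases hv : v = pf n2
    · subst hv
      simp only [if_true, or_true, and_true]
      rw [if_neg (by simp; omega)]
      simp; exact eq_comm
    · simp only [hv, if_false, or_false]
      split_ifs with hh
      · obtain ⟨a, k, b⟩ := hh
        have := ((A3 _ _).1 b).2
        subst this
        exact absurd a hnadj
      · exact A3 v h
  have A7 : ∀ n, n2 < n → n ≤ n3 → ∀ v h, cfg n v = some (c, h) ↔
      h = t-1 ∧ (v = pf n1 ∨ v = pf n2) := by
    intro n hn hn' v h
    rw [const_other h1 h2 (n2+1) n (by omega) (by omega)
      (fun n a b e => by have := honly n (by omega) e; omega), A4]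
  have A8 : ∀ v, (v = pf n1 ∨ v = pf n2) → G.Adj (pf n3) v := by
    intro v hv
    by_contra hna
    have a := (A7 n3 h23 le_rfl v (t-1)).2 ⟨rfl, hv⟩
    apply A6 v (t-1)
    rw [h2 n3 (by omega), e3]
    unfold place
    have : v ≠ pf n3 := by
      rintro rfl
      rw [h1 n3 h3N] at a; simp at a
    simp only [this, if_false]
    rw [if_neg (fun hh => hna hh.1)]
    exact a
  exact ⟨A8 _ (Or.inl rfl), A8 _ (Or.inr rfl), hne, A7⟩

end Aux

section Comb

variable {m : ℕ} {T : SimpleGraph (Fin m)}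

lemma adj_iff (a b : Fin m × GadgetV) : (treeGadgets m T).Adj a b ↔
    a ≠ b ∧ (((a.1 = b.1 ∧ gadgetRel a.2 b.2) ∨ (a.2 = .s ∧ b.2 = .s ∧ T.Adj a.1 b.1)) ∨
    ((b.1 = a.1 ∧ gadgetRel b.2 a.2) ∨ (b.2 = .s ∧ a.2 = .s ∧ T.Adj b.1 a.1))) := by
  simp [treeGadgets, SimpleGraph.fromRel_adj]

lemma adj_lb {w : Fin m × GadgetV} {j i} (h : (treeGadgets m T).Adj w (j, .lb i)) :
    w = (j, .la i) := by
  rw [adj_iff] at h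
  obtain ⟨k, w⟩ := w
  simp [gadgetRel] at h
  obtain ⟨_, h⟩ := h
  simp [h.1, h.2]

lemma adj_la {w : Fin m × GadgetV} {j i} (h : (treeGadgets m T).Adj w (j, .la i)) :
    w = (j, .x) ∨ w = (j, .lb i) := by
  rw [adj_iff] at h
  obtain ⟨k, w⟩ := w
  simp [gadgetRel] at h
  obtain ⟨_, h⟩ := h
  rcases h with h | h <;> simp [h.1, h.2]

lemma adj_x {w : Fin m × GadgetV} {j} (h : (treeGadgets m T).Adj w (j, .x)) :
    w = (j, .s) ∨ ∃ i, w = (j, .la i) := by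
  rw [adj_iff] at h
  obtain ⟨k, w⟩ := w
  simp [gadgetRel] at h
  obtain ⟨_, h, h'⟩ := h
  rcases h' with h' | ⟨i, h'⟩ 
  · simp [h, h']
  · simp [h, h']

lemma adj_s {w : Fin m × GadgetV} {j} (h : (treeGadgets m T).Adj w (j, .s)) :
    w = (j, .x) ∨ ∃ k, k ≠ j ∧ w = (k, .s) := by
  rw [adj_iff] at h
  obtain ⟨k, w⟩ := w
  simp only [gadgetRel] at h
  obtain ⟨h0, h⟩ := h
  simp at h h0
  rcases h with (h | h) | h
  · simp [h]
  · right; exact ⟨k, fun e => h0 e h.1, by simp [h.1]⟩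
  · right; exact ⟨k, fun e => h0 e h.1, by simp [h.1]⟩

variable {K : Type*} [Fintype K] {u v : K → Fin m × GadgetV}

lemma card_closed (hu : Function.Injective u) (hv : Function.Injective v)
    (huv : ∀ c d, u c ≠ v d) (Q : Fin m × GadgetV → Prop) (hQ : ∀ c, Q (u c) ↔ Q (v c)) :
    (Finset.univ.filter (fun a => (∃ c, u c = a ∨ v c = a) ∧ Q a)).card =
      2 * (Finset.univ.filter (fun c => Q (u c))).card := by
  have : Finset.univ.filter (fun a => (∃ c, u c = a ∨ v c = a) ∧ Q a) =
      (Finset.univ.filter (fun c => Q (u c))).image u ∪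
      (Finset.univ.filter (fun c => Q (u c))).image v := by
    ext a
    simp only [Finset.mem_filter, Finset.mem_univ, true_and, Finset.mem_union, Finset.mem_image]
    constructor
    · rintro ⟨⟨c, rfl | rfl⟩, h⟩
      · exact Or.inl ⟨c, h, rfl⟩
      · exact Or.inr ⟨c, (hQ c).2 h, rfl⟩
    · rintro (⟨c, h, rfl⟩ | ⟨c, h, rfl⟩)
      · exact ⟨⟨c, Or.inl rfl⟩, h⟩
      · exact ⟨⟨c, Or.inr rfl⟩, (hQ c).1 h⟩
  rw [this, Finset.card_union_of_disjoint, Finset.card_image_of_injective _ hu,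
    Finset.card_image_of_injective _ hv, two_mul]
  rw [Finset.disjoint_left]
  intro a ha hb
  simp at ha hb
  obtain ⟨c, _, rfl⟩ := ha
  obtain ⟨d, _, e⟩ := hb
  exact huv c d e.symm

/-- the two copies of colour `c` sit at `a` and `b`. -/
def Rr (u v : K → Fin m × GadgetV) (c : K) (a b : Fin m × GadgetV) : Prop :=
  (u c = a ∧ v c = b) ∨ (v c = a ∧ u c = b)

lemma card_six_a : (Finset.univ.filter (fun w : GadgetV => ∀ i, w ≠ .lb i)).card = 6 := by
  have : Finset.univ.filter (fun w : GadgetV => ∀ i, w ≠ .lb i) =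
    {.x, .s, .la 0, .la 1, .la 2, .la 3} := by
    ext w
    rcases w with _ | _ | i | i
    · simp
    · simp
    · fin_cases i <;> simp
    · simp
  rw [this]; rfl

lemma card_six_b (i : Fin 4) : (Finset.univ.filter (fun w : GadgetV =>
    w ≠ .la i ∧ ∀ k, k ≠ i → w ≠ .lb k)).card = 6 := by
  have : Finset.univ.filter (fun w : GadgetV => w ≠ .la i ∧ ∀ k, k ≠ i → w ≠ .lb k) =
    {.x, .s, .lb i, .la (i+1), .la (i+2), .la (i+3)} := by
    ext w
    rcases w with _ | _ | k | k
    · simp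
    · simp
    · fin_cases i <;> fin_cases k <;> simp
    · fin_cases i <;> fin_cases k <;> simp <;> decide
  rw [this]
  fin_cases i <;> rfl

theorem comb {w : K → Fin m × GadgetV} (τ : K → ℕ) (hu : Function.Injective u)
    (hv : Function.Injective v) (huv : ∀ c d, u c ≠ v d) (hK : Fintype.card K = 3 * m)
    (au : ∀ c, (treeGadgets m T).Adj (w c) (u c)) (av : ∀ c, (treeGadgets m T).Adj (w c) (v c))
    (hτ : ∀ c d, (u d = w c ∨ v d = w c) → τ d < τ c) (j : Fin m) :
    (Finset.univ.filter (fun z : GadgetV => ∃ c, u c = (j, z) ∨ v c = (j, z))).card = 6 ∧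
    ∀ c, (u c).1 = j ↔ (v c).1 = j := by
  -- basic facts on R
  have Rsymm : ∀ {c a b}, Rr u v c a b → Rr u v c b a := by
    intro c a b h
    rcases h with h | h
    · exact Or.inr ⟨h.2, h.1⟩
    · exact Or.inl ⟨h.2, h.1⟩
  have Runiq : ∀ {c d a b b'}, Rr u v c a b → Rr u v d a b' → c = d ∧ b = b' := by
    intro c d a b b' h h'
    rcases h with ⟨h1, h2⟩ | ⟨h1, h2⟩ <;> rcases h' with ⟨h3, h4⟩ | ⟨h3, h4⟩
    · have := hu (h1.trans h3.symm); subst this; exact ⟨rfl, h2.symm.trans h4⟩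
    · exact absurd (h1.trans h3.symm) (huv _ _)
    · exact absurd (h3.trans h1.symm) (huv _ _)
    · have := hv (h1.trans h3.symm); subst this; exact ⟨rfl, h2.symm.trans h4⟩
  have Rne : ∀ {c a b}, Rr u v c a b → a ≠ b := by
    intro c a b h e
    subst e
    rcases h with ⟨h1, h2⟩ | ⟨h1, h2⟩
    · exact huv c c (h1.trans h2.symm)
    · exact huv c c (h2.trans h1.symm)
  have Radj : ∀ {c a b}, Rr u v c a b → (treeGadgets m T).Adj (w c) a := by
    intro c a b h
    rcases h with ⟨h1, h2⟩ | ⟨h1, h2⟩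
    · exact h1 ▸ au c
    · exact h1 ▸ av c
  have Rτ : ∀ {c d b}, Rr u v d (w c) b → τ d < τ c := by
    intro c d b h
    rcases h with ⟨h1, h2⟩ | ⟨h1, h2⟩
    · exact hτ c d (Or.inl h1)
    · exact hτ c d (Or.inr h1)
  have Rex : ∀ {a}, (∃ c, u c = a ∨ v c = a) ↔ ∃ c b, Rr u v c a b := by
    intro a
    constructor
    · rintro ⟨c, h | h⟩
      · exact ⟨c, _, Or.inl ⟨h, rfl⟩⟩
      · exact ⟨c, _, Or.inr ⟨h, rfl⟩⟩
    · rintro ⟨c, b, h | h⟩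
      · exact ⟨c, Or.inl h.1⟩
      · exact ⟨c, Or.inr h.1⟩
  have Ruv : ∀ c, Rr u v c (u c) (v c) := fun c => Or.inl ⟨rfl, rfl⟩
  -- geometry
  have Glb : ∀ {c j i b}, Rr u v c (j, .lb i) b → w c = (j, .la i) ∧ b = (j, .x) := by
    intro c j i b h
    have h1 := adj_lb (Radj h)
    refine ⟨h1, ?_⟩
    have h2 := Radj (Rsymm h)
    rw [h1] at h2
    rcases adj_la h2.symm with h3 | h3
    · exact h3
    · exact absurd h3.symm (Rne h)
  have Gla : ∀ {c j i b}, Rr u v c (j, .la i) b →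
      w c = (j, .x) ∧ (b = (j, .s) ∨ ∃ k, b = (j, .la k)) := by
    intro c j i b h
    have h2 := Radj (Rsymm h)
    rcases adj_la (Radj h) with h1 | h1
    · refine ⟨h1, ?_⟩
      rw [h1] at h2
      exact adj_x h2.symm
    · rw [h1] at h2
      exact absurd (adj_lb h2.symm).symm (Rne h)
  have Gx : ∀ {c j b}, Rr u v c (j, .x) b →
      (∃ i, b = (j, .lb i)) ∨ (w c = (j, .s) ∧ ∃ k, k ≠ j ∧ b = (k, .s)) := by
    intro c j b h
    have h2 := Radj (Rsymm h)
    rcases adj_x (Radj h) with h1 | ⟨i, h1⟩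
    · right
      rw [h1] at h2
      rcases adj_s h2.symm with h3 | h3
      · exact absurd h3.symm (Rne h)
      · exact ⟨h1, h3⟩
    · left
      rw [h1] at h2
      rcases adj_la h2.symm with h3 | h3
      · exact absurd h3.symm (Rne h)
      · exact ⟨i, h3⟩
  -- occupancy
  let occ : Fin m → Finset GadgetV := fun j =>
    Finset.univ.filter (fun z : GadgetV => ∃ c, u c = (j, z) ∨ v c = (j, z))
  have mocc : ∀ {j z}, z ∈ occ j ↔ ∃ c b, Rr u v c (j, z) b := by
    intro j z
    simp only [occ, Finset.mem_filter, Finset.mem_univ, true_and]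
    exact Rex
  have sub : ∀ j, occ j ⊆ Finset.univ.filter (fun w : GadgetV => ∀ i, w ≠ .lb i) ∨
      ∃ i, (∃ c, Rr u v c (j, .lb i) (j, .x)) ∧ occ j ⊆ Finset.univ.filter (fun w : GadgetV =>
        w ≠ .la i ∧ ∀ k, k ≠ i → w ≠ .lb k) := by
    intro j
    by_cases h : ∃ i, GadgetV.lb i ∈ occ j
    · right
      obtain ⟨i, hi⟩ := h
      obtain ⟨c, b, hc⟩ := mocc.1 hi
      obtain ⟨hw, hb⟩ := Glb hc
      subst hb
      refine ⟨i, ⟨c, hc⟩, ?_⟩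
      intro z hz
      obtain ⟨d, b, hd⟩ := mocc.1 hz
      simp only [Finset.mem_filter, Finset.mem_univ, true_and]
      constructor
      · rintro rfl
        have h1 := (Gla hd).1
        have h2 : τ d < τ c := Rτ (b := b) (by rw [hw]; exact hd)
        have h3 : τ c < τ d := Rτ (b := (j, .lb i)) (by rw [h1]; exact Rsymm hc)
        omega
      · rintro k hk rfl
        obtain ⟨_, hb⟩ := Glb hd
        subst hb
        have := (Runiq (Rsymm hc) (Rsymm hd)).2
        simp at this
        exact hk this.symm
    · left
      push Not at h
      intro z hz
      simp only [Finset.mem_filter, Finset.mem_univ, true_and]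
      rintro i rfl
      exact h i hz
  have le6 : ∀ j, (occ j).card ≤ 6 := by
    intro j
    rcases sub j with h | ⟨i, _, h⟩
    · exact (Finset.card_le_card h).trans card_six_a.le
    · exact (Finset.card_le_card h).trans (card_six_b i).le
  have tot : ∑ j, (occ j).card = ∑ j : Fin m, 6 := by
    have h1 := card_closed hu hv huv (fun _ => True) (fun _ => Iff.rfl)
    have h2 : (Finset.univ.sigma occ).card = (Finset.univ.filter
        (fun a => (∃ c, u c = a ∨ v c = a) ∧ True)).card := by
      apply Finset.card_bij (fun a _ => (a.1, a.2))
      · rintro ⟨j, z⟩ h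
        simpa [occ] using h
      · rintro ⟨j, z⟩ _ ⟨j', z'⟩ _ h
        simp at h
        simp [h]
      · rintro ⟨j, z⟩ h
        exact ⟨⟨j, z⟩, by simpa [occ] using h, rfl⟩
    rw [Finset.card_sigma] at h2
    have h3 : ∑ a, (occ a).card = 2 * (Finset.univ.filter (fun _ : K => True)).card := by
      rw [h2]; convert h1
    rw [h3]
    simp [hK]
    ring
  have eq6 : ∀ j, (occ j).card = 6 := by
    intro j
    exact (Finset.sum_eq_sum_iff_of_le (fun j _ => le6 j)).1 tot j (Finset.mem_univ _)
  have cases : ∀ j, occ j = Finset.univ.filter (fun w : GadgetV => ∀ i, w ≠ .lb i) ∨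
      ∃ i, (∃ c, Rr u v c (j, .lb i) (j, .x)) ∧ occ j = Finset.univ.filter (fun w : GadgetV =>
        w ≠ .la i ∧ ∀ k, k ≠ i → w ≠ .lb k) := by
    intro j
    rcases sub j with h | ⟨i, hc, h⟩
    · left
      exact Finset.eq_of_subset_of_card_le h (by rw [card_six_a, eq6])
    · right
      exact ⟨i, hc, Finset.eq_of_subset_of_card_le h (by rw [card_six_b, eq6])⟩
  -- parity
  have par : ∀ j (Z : Finset GadgetV), (∀ z ∈ Z, ∀ c b, Rr u v c (j, z) b → b.1 = j ∧ b.2 ∈ Z) →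
      Even (occ j ∩ Z).card := by
    intro j Z hZ
    have h1 := card_closed hu hv huv (fun a => a.1 = j ∧ a.2 ∈ Z) (by
      intro c
      constructor
      · intro h
        refine hZ _ h.2 c _ ?_
        rw [← h.1]; exact Ruv c
      · intro h
        refine hZ _ h.2 c _ ?_
        rw [← h.1]; exact Rsymm (Ruv c))
    have h2 : (occ j ∩ Z).card = (Finset.univ.filter (fun a =>
        (∃ c, u c = a ∨ v c = a) ∧ (a.1 = j ∧ a.2 ∈ Z))).card := by
      apply Finset.card_bij (fun z _ => (j, z))
      · intro z h
        simpa [occ] using h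
      · intro z _ z' _ h
        simpa using h
      · rintro ⟨j', z⟩ h
        simp at h
        obtain ⟨h, rfl, h'⟩ := h
        exact ⟨z, by simpa [occ] using ⟨h, h'⟩, rfl⟩
    have h3 : (occ j ∩ Z).card =
        2 * (Finset.univ.filter (fun c => (u c).1 = j ∧ (u c).2 ∈ Z)).card := by
      rw [h2]; convert h1
    rw [h3]
    exact even_two_mul _
  -- in a gadget of the second kind, s is paired with some la
  have caseA : ∀ j i, occ j = Finset.univ.filter (fun w : GadgetV =>
        w ≠ .la i ∧ ∀ k, k ≠ i → w ≠ .lb k) → ∃ c k, Rr u v c (j, .s) (j, .la k) := by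
    intro j i h
    by_contra hno
    push Not at hno
    have := par j {.la 0, .la 1, .la 2, .la 3} (by
      intro z hz c b hc
      obtain ⟨k, rfl⟩ : ∃ k, z = .la k := by
        simp at hz; rcases hz with h | h | h | h <;> exact ⟨_, h⟩
      rcases (Gla hc).2 with rfl | ⟨k', rfl⟩
      · exact absurd (Rsymm hc) (hno _ _)
      · refine ⟨rfl, ?_⟩
        fin_cases k' <;> simp)
    have h3 : occ j ∩ {.la 0, .la 1, .la 2, .la 3} = {.la (i+1), .la (i+2), .la (i+3)} := by
      rw [h]
      ext z
      rcases z with _ | _ | k | k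
      · simp
      · simp
      · fin_cases i <;> fin_cases k <;> simp
      · simp
    rw [h3] at this
    have h4 : ({.la (i+1), .la (i+2), .la (i+3)} : Finset GadgetV).card = 3 := by
      fin_cases i <;> rfl
    rw [h4] at this
    exact absurd this (by decide)
  have caseB : ∀ j, occ j = Finset.univ.filter (fun w : GadgetV => ∀ i, w ≠ .lb i) →
      ∃ c k, w c = (j, .s) ∧ k ≠ j ∧ Rr u v c (j, .x) (k, .s) := by
    intro j h
    have hx : GadgetV.x ∈ occ j := by rw [h]; simp
    obtain ⟨c, b, hc⟩ := mocc.1 hx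
    rcases Gx hc with ⟨i, rfl⟩ | ⟨hw, k, hk, rfl⟩
    · have : GadgetV.lb i ∈ occ j := mocc.2 ⟨c, _, Rsymm hc⟩
      rw [h] at this
      simp at this
    · exact ⟨c, k, hw, hk, hc⟩
  -- no gadget of the first kind
  have noB : ∀ j, occ j ≠ Finset.univ.filter (fun w : GadgetV => ∀ i, w ≠ .lb i) := by
    intro j0 hj0
    obtain ⟨c0, k0, h0⟩ := caseB j0 hj0
    let F : Finset K := Finset.univ.filter (fun c => ∃ j k,
      occ j = Finset.univ.filter (fun w : GadgetV => ∀ i, w ≠ .lb i) ∧ 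
      k ≠ j ∧ Rr u v c (j, .x) (k, .s))
    have hF : F.Nonempty := ⟨c0, by simp only [F, Finset.mem_filter, Finset.mem_univ, true_and]; exact ⟨j0, k0, hj0, h0.2⟩⟩
    obtain ⟨c, hcF, hmax⟩ := Finset.exists_max_image F τ hF
    simp only [F, Finset.mem_filter, Finset.mem_univ, true_and] at hcF
    obtain ⟨j, k, hj, hkj, hc⟩ := hcF
    rcases cases k with hk | ⟨i, _, hk⟩
    · obtain ⟨d, l, hw, hl, hd⟩ := caseB k hk
      have h1 : τ c < τ d := Rτ (b := (j, .x)) (by rw [hw]; exact Rsymm hc)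
      have h2 := hmax d (by
        simp only [F, Finset.mem_filter, Finset.mem_univ, true_and]; exact ⟨k, l, hk, hl, hd⟩)
      omega
    · obtain ⟨d, l, hd⟩ := caseA k i hk
      have := (Runiq hd (Rsymm hc)).2
      simp at this
  have key : ∀ j c z b, Rr u v c (j, z) b → b.1 = j := by
    intro j c z b hc
    rcases cases j with hj | ⟨i, ⟨d, hd⟩, hj⟩
    · exact absurd hj (noB j)
    rcases z with _ | _ | k | k
    · rw [← (Runiq (Rsymm hd) hc).2]
    · obtain ⟨e, l, he⟩ := caseA j i hj
      rw [← (Runiq he hc).2]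
    · rcases (Gla hc).2 with rfl | ⟨_, rfl⟩ <;> rfl
    · rw [(Glb hc).2]
  refine ⟨eq6 j, fun c => ⟨?_, ?_⟩⟩
  · rintro rfl
    exact key _ c (u c).2 _ (Ruv c)
  · rintro rfl
    exact key _ c (v c).2 _ (Rsymm (Ruv c))

end Comb

section Idx

lemma flatMap_get {α β : Type*} (f : α → List β) (k : ℕ) (hf : ∀ a, (f a).length = k) (r : ℕ)
    (hr : r < k) : ∀ (l : List α) (q : ℕ),
    (l.flatMap f)[k*q+r]? = (l[q]?).bind (fun a => (f a)[r]?) := by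
  intro l
  induction l with
  | nil => intro q; simp
  | cons a l ih =>
    intro q
    rw [List.flatMap_cons]
    cases q with
    | zero => rw [List.getElem?_append_left (by rw [hf]; omega)]; simp
    | succ q =>
      rw [List.getElem?_append_right (by rw [hf]; nlinarith), hf]
      have : k * (q+1) + r - k = k * q + r := by
        rw [Nat.mul_add, mul_one]; omega
      rw [this, ih]
      simp

variable {m : ℕ} {a : Fin (3*m) → ℕ} {t : ℕ}

lemma len_init : (SinitialG m t).length = 6 * m := by
  simp [SinitialG, List.length_flatMap, mul_comm]
lemma len_A : (SAG m a).length = 3 * m := by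
  simp [SAG]
lemma len_conn : (SconnectorG m t).length = 3 * m := by
  simp [SconnectorG, List.length_flatMap, mul_comm]
lemma len_fin : (SfinalG m).length = 4 * m := by
  simp [SfinalG, List.length_flatMap, mul_comm]
lemma len_full : (SfullG m a t).length = 16 * m := by
  simp only [SfullG, List.length_append, len_init, len_A, len_conn, len_fin]; ring

lemma get_init (j : Fin m) (k : Fin 3) (b : ℕ) (hb : b < 2) :
    (SfullG m a t)[6*j.1+(2*k.1+b)]? = some (some (j, k), t-1) := by
  have := j.2
  unfold SfullG
  rw [List.getElem?_append_left, List.getElem?_append_left, List.getElem?_append_left]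
  · rw [SinitialG, flatMap_get _ 6 (by simp) _ (by omega)]
    simp
    interval_cases b <;> fin_cases k <;> simp
  all_goals simp only [List.length_append, len_init, len_A, len_conn]; omega

lemma get_conn (j : Fin m) (k : Fin 3) :
    (SfullG m a t)[9*m + (3*j.1+k.1)]? = some (some (j, k), t-1) := by
  have := j.2
  unfold SfullG
  rw [List.getElem?_append_left, List.getElem?_append_right]
  · simp only [List.length_append, len_init, len_A]
    have : 9*m + (3*j.1+k.1) - (6*m+3*m) = 3*j.1+k.1 := by omega
    rw [this, SconnectorG, flatMap_get _ 3 (by simp) _ (by omega)]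
    simp
    fin_cases k <;> simp
  all_goals simp only [List.length_append, len_init, len_A, len_conn]; omega

lemma get_A (n : ℕ) (h1 : 6*m ≤ n) (h2 : n < 9*m) (s : GColor m × ℕ)
    (hs : (SfullG m a t)[n]? = some s) : s.1 = none := by
  unfold SfullG at hs
  rw [List.getElem?_append_left, List.getElem?_append_left, List.getElem?_append_right] at hs
  · have := List.mem_of_getElem? hs
    simp [SAG] at this
    obtain ⟨_, rfl⟩ := this
    rfl
  all_goals simp only [List.length_append, len_init, len_A, len_conn]; omega

lemma get_fin (n : ℕ) (h1 : 12*m ≤ n) (s : GColor m × ℕ)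
    (hs : (SfullG m a t)[n]? = some s) : s.1 = none := by
  unfold SfullG at hs
  rw [List.getElem?_append_right] at hs
  · have := List.mem_of_getElem? hs
    simp [SfinalG] at this
    simp [this.2]
  all_goals simp only [List.length_append, len_init, len_A, len_conn]; omega

lemma idx_init (n : ℕ) (h : n < 6*m) : ∃ (j : Fin m) (k : Fin 3),
    n = 6*j.1+(2*k.1+0) ∨ n = 6*j.1+(2*k.1+1) :=
  ⟨⟨n/6, by omega⟩, ⟨(n%6)/2, by omega⟩, by simp only; omega⟩

lemma idx_conn (n : ℕ) (h1 : 9*m ≤ n) (h : n < 12*m) : ∃ (j : Fin m) (k : Fin 3),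
    n = 9*m+(3*j.1+k.1) :=
  ⟨⟨(n-9*m)/3, by omega⟩, ⟨(n-9*m)%3, by omega⟩, by simp only; omega⟩

lemma idx_only (n : ℕ) (j : Fin m) (k : Fin 3) (h : ℕ)
    (hs : (SfullG m a t)[n]? = some (some (j, k), h)) :
    n = 6*j.1+(2*k.1+0) ∨ n = 6*j.1+(2*k.1+1) ∨ n = 9*m+(3*j.1+k.1) := by
  by_cases c1 : n < 6*m
  · obtain ⟨j', k', e | e⟩ := idx_init n c1
    · rw [e, get_init j' k' 0 (by omega)] at hs
      simp at hs
      obtain ⟨⟨rfl, rfl⟩, _⟩ := hs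
      simp [e]
    · rw [e, get_init j' k' 1 (by omega)] at hs
      simp at hs
      obtain ⟨⟨rfl, rfl⟩, _⟩ := hs
      simp [e]
  by_cases c2 : n < 9*m
  · have := get_A n (by omega) c2 _ hs
    simp at this
  by_cases c3 : n < 12*m
  · obtain ⟨j', k', e⟩ := idx_conn n (by omega) c3
    rw [e, get_conn j' k'] at hs
    simp at hs
    obtain ⟨⟨rfl, rfl⟩, _⟩ := hs
    simp [e]
  · have := get_fin n (by omega) _ hs
    simp at this

end Idx

/-- on the connected tree-of-gadgets graph, in any emptying placement of
the 3-Partition-derived sequence, after placing `S_initial` every gadget contains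
exactly six stacks, and these use exactly three colors, each color having both of its
stacks within that same gadget. -/
theorem statement_8 (m B : ℕ) (hB : 0 < B) (a : Fin (3*m) → ℕ)
    (ha : ∀ i, B < 4 * a i ∧ 2 * a i < B)
    (hsum : ∑ i, a i = m * B)
    (T : SimpleGraph (Fin m)) (hT : T.IsTree)
    (p : List (Fin m × GadgetV))
    (hleg : Legal (treeGadgets m T) (B+4)
      (emptyConfig (Fin m × GadgetV) (GColor m)) (SfullG m a (B+4)) p)
    (hemp : play (treeGadgets m T) (B+4)
      (emptyConfig (Fin m × GadgetV) (GColor m)) (SfullG m a (B+4)) p =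
      emptyConfig (Fin m × GadgetV) (GColor m)) :
    ∀ δ0 : Config (Fin m × GadgetV) (GColor m),
      δ0 = play (treeGadgets m T) (B+4) (emptyConfig (Fin m × GadgetV) (GColor m))
        ((SfullG m a (B+4)).take (6*m)) (p.take (6*m)) →
      ∀ j : Fin m,
        (Finset.univ.filter (fun w : GadgetV => δ0 (j, w) ≠ none)).card = 6 ∧
        (∃ cs : Finset (GColor m), cs.card = 3 ∧
          ∀ (q : ℕ) (sq : GColor m × ℕ) (wq : Fin m × GadgetV), q < 6*m →
            (SfullG m a (B+4))[q]? = some sq → p[q]? = some wq →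
            (wq.1 = j ↔ sq.1 ∈ cs)) := by
  intro δ0 hδ0 j
  have hlen := legal_length hleg
  rw [len_full] at hlen
  let cfg : ℕ → Config (Fin m × GadgetV) (GColor m) := fun n =>
    play (treeGadgets m T) (B+4) (emptyConfig _ _) ((SfullG m a (B+4)).take n) (p.take n)
  let Sf : ℕ → GColor m × ℕ := fun n => ((SfullG m a (B+4))[n]?).getD (none, 0)
  let pf : ℕ → Fin m × GadgetV := fun n => (p[n]?).getD (j, .x)
  have hS : ∀ n < 16*m, (SfullG m a (B+4))[n]? = some (Sf n) := by
    intro n hn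
    simp only [Sf]
    rw [List.getElem?_eq_getElem (by rw [len_full]; exact hn)]; rfl
  have hp : ∀ n < 16*m, p[n]? = some (pf n) := by
    intro n hn
    simp only [pf]
    rw [List.getElem?_eq_getElem (by rw [← hlen]; exact hn)]; rfl
  have h1 : ∀ n < 16*m, cfg n (pf n) = none := fun n hn =>
    (legal_step hleg n _ _ (hS n hn) (hp n hn)).1
  have h2 : ∀ n < 16*m, cfg (n+1) = place (treeGadgets m T) (B+4) (cfg n) (Sf n) (pf n) :=
    fun n hn => (legal_step hleg n _ _ (hS n hn) (hp n hn)).2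
  have h0 : cfg 0 = emptyConfig _ _ := by simp [cfg, play]
  have hN : cfg (16*m) = emptyConfig _ _ := by
    simp only [cfg]
    rw [List.take_of_length_le (by rw [len_full]), List.take_of_length_le (by rw [← hlen])]
    exact hemp
  let n1 : Fin m × Fin 3 → ℕ := fun c => 6*c.1.1+(2*c.2.1+0)
  let n2 : Fin m × Fin 3 → ℕ := fun c => 6*c.1.1+(2*c.2.1+1)
  let n3 : Fin m × Fin 3 → ℕ := fun c => 9*m+(3*c.1.1+c.2.1)
  have b12 : ∀ c, n1 c < n2 c := fun c => by simp only [n1, n2]; omega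
  have b2 : ∀ c, n2 c < 6*m := fun c => by
    have := c.1.2; have := c.2.2; simp only [n2]; omega
  have b3 : ∀ c, 9*m ≤ n3 c := fun c => by simp only [n3]; omega
  have b3' : ∀ c, n3 c < 12*m := fun c => by
    have := c.1.2; have := c.2.2; simp only [n3]; omega
  have life := fun c : Fin m × Fin 3 => color_life (G := treeGadgets m T) (t := B+4) (by omega)
    h1 h2 h0 hN (c := some c) (n1 := n1 c) (n2 := n2 c) (n3 := n3 c) (b12 c)
    (by have := b2 c; have := b3 c; omega) (by have := b3' c; omega)
    (by simp only [Sf, n1]; rw [get_init _ _ _ (by omega)]; rfl)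
    (by simp only [Sf, n2]; rw [get_init _ _ _ (by omega)]; rfl)
    (by simp only [Sf, n3]; rw [get_conn]; rfl)
    (by
      intro n hn e
      have := hS n hn
      have e' : Sf n = (some (c.1, c.2), (Sf n).2) := by rw [← e]
      rw [e'] at this
      exact idx_only n _ _ _ this)
  have col : ∀ c z, (z = pf (n1 c) ∨ z = pf (n2 c)) → ∀ n, 6*m ≤ n → n ≤ n3 c →
      cfg n z = some (some c, B+4-1) := fun c z hz n ha hb =>
    ((life c).2.2.2 n (by have := b2 c; omega) hb z _).2 ⟨rfl, hz⟩
  have col6 : ∀ c z, (z = pf (n1 c) ∨ z = pf (n2 c)) → cfg (6*m) z = some (some c, B+4-1) :=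
    fun c z hz => col c z hz _ le_rfl (by have := b3 c; omega)
  have inj : ∀ c d z, (z = pf (n1 c) ∨ z = pf (n2 c)) → (z = pf (n1 d) ∨ z = pf (n2 d)) →
      c = d := by
    intro c d z hc hd
    have e := (col6 c z hc).symm.trans (col6 d z hd)
    simpa using e
  obtain ⟨hcard, hsame⟩ := comb (T := T) (u := fun c => pf (n1 c)) (v := fun c => pf (n2 c))
    (w := fun c => pf (n3 c)) n3
    (fun c d h => inj c d _ (Or.inl rfl) (Or.inl h))
    (fun c d h => inj c d _ (Or.inr rfl) (Or.inr h))
    (fun c d h => by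
      have := inj c d _ (Or.inl rfl) (Or.inr h)
      subst this
      exact (life c).2.2.1 h)
    (by simp; ring)
    (fun c => (life c).1) (fun c => (life c).2.1)
    (by
      intro c d h
      by_contra hlt
      have e := col d (pf (n3 c)) (by rcases h with h | h <;> simp [h]) (n3 c)
        (by have := b3 c; omega) (by omega)
      rw [h1 (n3 c) (by have := b3' c; omega)] at e
      simp at e) j
  have hocc : ∀ z : GadgetV, δ0 (j, z) ≠ none ↔
      ∃ c, pf (n1 c) = (j, z) ∨ pf (n2 c) = (j, z) := by
    intro z
    have e0 : δ0 = cfg (6*m) := hδ0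
    rw [e0]
    constructor
    · intro h
      rcases hz : cfg (6*m) (j, z) with _ | ⟨c, hh⟩
      · exact absurd hz h
      rcases c with _ | c
      · rw [const_other h1 h2 0 (6*m) (by omega) (by omega) (by
          intro n _ hn e
          obtain ⟨j', k', e' | e'⟩ := idx_init n hn
          · have := hS n (by omega)
            rw [e', get_init _ _ _ (by omega), ← e'] at this
            simp at this
            rw [← this] at e
            simp at e
          · have := hS n (by omega)
            rw [e', get_init _ _ _ (by omega), ← e'] at this
            simp at this
            rw [← this] at e
            simp at e), h0] at hz
        simp [emptyConfig] at hz
      · have := ((life c).2.2.2 (6*m) (b2 c) (by have := b3 c; omega) _ _).1 hz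
        exact ⟨c, by rcases this.2 with h | h <;> simp [← h]⟩
    · rintro ⟨c, h⟩
      rw [col6 c (j, z) (by rcases h with h | h <;> simp [h])]
      simp
  have hcard' : (Finset.univ.filter (fun w : GadgetV => δ0 (j, w) ≠ none)).card = 6 := by
    rw [← hcard]
    congr 1
    ext z
    simp only [Finset.mem_filter, Finset.mem_univ, true_and]
    exact hocc z
  refine ⟨hcard', (Finset.univ.filter (fun c => (pf (n1 c)).1 = j)).image some, ?_, ?_⟩
  · rw [Finset.card_image_of_injective _ (Option.some_injective _)]
    have h3 := card_closed (u := fun c => pf (n1 c)) (v := fun c => pf (n2 c))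
      (fun c d h => inj c d _ (Or.inl rfl) (Or.inl h))
      (fun c d h => inj c d _ (Or.inr rfl) (Or.inr h))
      (fun c d h => by
        have := inj c d _ (Or.inl rfl) (Or.inr h)
        subst this
        exact (life c).2.2.1 h) (fun a => a.1 = j) hsame
    have h4 : (Finset.univ.filter (fun z : GadgetV =>
        ∃ c, pf (n1 c) = (j, z) ∨ pf (n2 c) = (j, z))).card =
        (Finset.univ.filter (fun a : Fin m × GadgetV =>
        (∃ c, pf (n1 c) = a ∨ pf (n2 c) = a) ∧ a.1 = j)).card := by
      apply Finset.card_bij (fun z _ => (j, z))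
      · intro z h
        simpa using h
      · intro z _ z' _ h
        simpa using h
      · rintro ⟨j', z⟩ h
        simp only [Finset.mem_filter, Finset.mem_univ, true_and] at h
        obtain ⟨h, rfl⟩ := h
        exact ⟨z, by simpa using h, rfl⟩
    have h5 : (6:ℕ) = 2 * (Finset.univ.filter (fun c => (pf (n1 c)).1 = j)).card := by
      rw [← hcard, h4]; convert h3
    have h6 : (Finset.univ.filter (fun c => (pf (n1 c)).1 = j)).card = 3 := by omega
    convert h6
  · intro q sq wq hq hsq hwq
    rw [hp q (by omega)] at hwq
    simp only [Option.some.injEq] at hwq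
    subst hwq
    obtain ⟨j', k', e | e⟩ := idx_init q hq
    · rw [e, get_init _ _ _ (by omega)] at hsq
      simp only [Option.some.injEq] at hsq
      subst hsq
      have : q = n1 (j', k') := e
      rw [this]
      simp
    · rw [e, get_init _ _ _ (by omega)] at hsq
      simp only [Option.some.injEq] at hsq
      subst hsq
      have : q = n2 (j', k') := e
      rw [this]
      rw [← hsame (j', k')]
      simp

end Hexasort
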